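/- (Core lemma of the proof of Corollary 3.1) Let U and W be continuous real functions on [t₁, +∞) such that U(t) ≥ 0 for all t ≥ t₁, ∫_{t₁}^{+∞} U(τ) dτ = +∞, and ∫_{t₁}^{t} W(τ) dτ → +∞ as t → +∞. Then the scalar Riccati equation z' + U(t) z² + W(t) = 0 has no solution defined on the whole half-line [t₁, +∞). -/

import Mathlib

open Set Filter MeasureTheory intervalIntegral

noncomputable section

theorem hasDerivWithinAt_integral_Ici {a t : ℝ} {f : ℝ → ℝ} (hf : ContinuousOn f (Ici a))
    (ht : a ≤ t) :
    HasDerivWithinAt (fun T => ∫ τ in a..T, f τ) (f t) (Ici a) t := by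
  have hg : Continuous fun x => f (max a x) :=
    hf.comp_continuous (by fun_prop) fun x => le_max_left a x
  have hd := (integral_hasDerivAt_right (hg.intervalIntegrable a t)
    hg.stronglyMeasurable.stronglyMeasurableAtFilter hg.continuousAt).hasDerivWithinAt
    (s := Ici a)
  have heq : ∀ T ∈ Ici a, (∫ τ in a..T, f τ) = ∫ τ in a..T, f (max a τ) := fun T hT =>
    integral_congr fun x hx => by
      rw [uIcc_of_le hT] at hx
      simp only [max_eq_right hx.1]
  simpa only [max_eq_right ht] using hd.congr heq (heq t ht)

theorem monotoneOn_Ici_of_hasDerivWithinAt_nonneg {a : ℝ} {f f' : ℝ → ℝ}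
    (hf : ∀ t ∈ Ici a, HasDerivWithinAt f (f' t) (Ici a) t) (hf' : ∀ t ∈ Ici a, 0 ≤ f' t) :
    MonotoneOn f (Ici a) :=
  monotoneOn_of_hasDerivWithinAt_nonneg (convex_Ici a)
    (fun t ht => (hf t ht).continuousWithinAt)
    (fun t ht => (hf t (interior_subset ht)).mono interior_subset)
    fun t ht => hf' t (interior_subset ht)

/-- Core lemma of the proof of Corollary 3.1: if `U, W` are continuous on `[t₁, +∞)`,
`U ≥ 0`, `∫_{t₁}^{+∞} U = +∞` and `∫_{t₁}^{t} W → +∞` as `t → +∞`, then the Riccati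
equation `z' + U z² + W = 0` has no solution on the whole of `[t₁, +∞)`. -/
theorem stmt14
    (t₁ : ℝ) (U W : ℝ → ℝ)
    (hU : ContinuousOn U (Ici t₁)) (hW : ContinuousOn W (Ici t₁))
    (hUnneg : ∀ t ≥ t₁, 0 ≤ U t)
    (hUdiv : Tendsto (fun T => ∫ τ in t₁..T, U τ) atTop atTop)
    (hWdiv : Tendsto (fun T => ∫ τ in t₁..T, W τ) atTop atTop) :
    ¬ ∃ z : ℝ → ℝ, ∀ t ∈ Ici t₁,
      HasDerivWithinAt z (-(U t * z t ^ 2 + W t)) (Ici t₁) t := by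
  rintro ⟨z, hz⟩
  set G : ℝ → ℝ := fun t => z t₁ - (∫ τ in t₁..t, W τ) - z t with hG
  have hGd : ∀ t ∈ Ici t₁, HasDerivWithinAt G (U t * z t ^ 2) (Ici t₁) t := fun t ht => by
    refine (((hasDerivWithinAt_integral_Ici hW ht).const_sub (z t₁)).sub (hz t ht)).congr_deriv ?_
    ring
  have hGmono : MonotoneOn G (Ici t₁) :=
    monotoneOn_Ici_of_hasDerivWithinAt_nonneg hGd fun t ht =>
      mul_nonneg (hUnneg t ht) (sq_nonneg _)
  have hG0 : ∀ t ∈ Ici t₁, 0 ≤ G t := fun t ht => by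
    have h := hGmono self_mem_Ici ht ht
    simpa [hG] using h
  obtain ⟨T, hT⟩ := eventually_atTop.1
    ((hWdiv.eventually_ge_atTop (z t₁ + 1)).and (eventually_ge_atTop t₁))
  have hTt : t₁ ≤ T := (hT T le_rfl).2
  have hsub : Ici T ⊆ Ici t₁ := Ici_subset_Ici.2 hTt
  have hpos : ∀ t ∈ Ici T, 0 < 1 + G t := fun t ht => by linarith [hG0 t (hsub ht)]
  have hFmono : MonotoneOn (fun t => -(1 + G t)⁻¹ - ∫ τ in t₁..t, U τ) (Ici T) := by
    refine monotoneOn_Ici_of_hasDerivWithinAt_nonneg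
      (f' := fun t => -(-(U t * z t ^ 2) / (1 + G t) ^ 2) - U t) (fun t ht => ?_) fun t ht => ?_
    · exact ((((hGd t (hsub ht)).const_add 1).fun_inv (hpos t ht).ne').fun_neg.fun_sub
        (hasDerivWithinAt_integral_Ici hU (hsub ht))).mono hsub
    · have hle : 1 + G t ≤ -z t := by
        have := (hT t ht).1
        simp only [hG]
        linarith
      have hsq : (1 + G t) ^ 2 ≤ z t ^ 2 := by nlinarith [hpos t ht]
      have hmul := mul_le_mul_of_nonneg_left hsq (hUnneg t (hsub ht))
      have hdiv := (le_div_iff₀ (pow_pos (hpos t ht) 2)).2 hmul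
      rw [neg_div, neg_neg]
      linarith
  obtain ⟨t, htU, htT⟩ := ((hUdiv.eventually_gt_atTop
    ((1 + G T)⁻¹ + ∫ τ in t₁..T, U τ)).and (eventually_ge_atTop T)).exists
  have hle := hFmono self_mem_Ici htT htT
  have hinv := inv_pos.2 (hpos t htT)
  simp only at hle
  linarith
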